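/- arXiv:1506.00742 — 2 statements merged into one kernel-verified Lean document; each statement's English description precedes it below -/
import Mathlib

section
/- Let K be a complete nonarchimedean field of characteristic p > 0, and let L/K be an extension of complete valued fields such that K is separably closed in L and L embeds K-isometrically into the completed algebraic closure K' of K. Let H ≤ Gal(K^sep/K) be the subgroup of continuous automorphisms of K' fixing L pointwise, acting on K'. Then the fixed field (K')^H equals the completion of the perfect closure L^{1/p^∞} inside K'. -/
namespace AxSen

/-- Elements algebraic over a trivially normed subfield have norm at most one. -/
lemma norm_le_one_of_trivial {C : Type*} [NormedField C] [IsUltrametricDist C]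
    (L : Subfield C) (htriv : ∀ x : L, ‖x‖ ≤ 1) (a : C) (ha : IsIntegral L a) : ‖a‖ ≤ 1 := by
  let f : AlgebraNorm L C :=
    { toFun := fun x => ‖x‖
      map_zero' := norm_zero
      add_le' := norm_add_le
      neg' := norm_neg
      mul_le' := fun x y => norm_mul_le x y
      eq_zero_of_map_eq_zero' := fun x hx => norm_eq_zero.1 hx
      smul' := fun r x => by
        rw [Algebra.smul_def, norm_mul]; rfl }
  have h1 : f a ≤ spectralValue (minpoly L a) :=
    norm_root_le_spectralValue (f := f) (fun x n _ => norm_pow x n)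
      (fun x y => IsUltrametricDist.norm_add_le_max x y) (minpoly.monic ha) (minpoly.aeval L a)
  exact h1.trans ((spectralValue_le_one_iff (minpoly.monic ha)).2 fun n => htriv _)

/-- Automorphisms of the algebraic closure of a complete field are isometric. -/
lemma norm_aut {C : Type*} [NormedField C] [IsUltrametricDist C] [CompleteSpace C]
    (L : Subfield C) (hL : IsClosed (L : Set C))
    (σ : algebraicClosure L C →ₐ[L] algebraicClosure L C) (a : algebraicClosure L C) :
    ‖((σ a : algebraicClosure L C) : C)‖ = ‖(a : C)‖ := by
  by_cases htriv : ∃ x : L, x ≠ 0 ∧ ‖x‖ ≠ 1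
  · let : NontriviallyNormedField L := NontriviallyNormedField.ofNormNeOne htriv
    have : CompleteSpace L := hL.completeSpace_coe
    have : IsUltrametricDist L := ⟨fun x y z => IsUltrametricDist.dist_triangle_max x.1 y.1 z.1⟩
    let f : AbsoluteValue (algebraicClosure L C) ℝ :=
      (NormedField.toAbsoluteValue C).comp (f := (algebraicClosure L C).val.toRingHom)
        (RingHom.injective _)
    let g : AbsoluteValue (algebraicClosure L C) ℝ := f.comp (f := σ.toRingHom)
        (RingHom.injective _)
    have hf : ∀ x : L, f (algebraMap L _ x) = ‖x‖ := fun x => rfl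
    have hg : ∀ x : L, g (algebraMap L _ x) = ‖x‖ := fun x => by
      change f (σ (algebraMap L _ x)) = _
      rw [σ.commutes, hf]
    have := (spectralNorm_unique_field_norm_ext hg a).trans
      (spectralNorm_unique_field_norm_ext hf a).symm
    exact this
  · push Not at htriv
    have h1 : ∀ x : L, ‖x‖ ≤ 1 := fun x => by
      by_cases hx : x = 0
      · simp [hx]
      · exact (htriv x hx).le
    have h2 : ∀ b : algebraicClosure L C, ‖(b : C)‖ ≤ 1 := fun b =>
      norm_le_one_of_trivial L h1 _ (mem_algebraicClosure_iff.1 b.2).isIntegral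
    have h3 : ∀ b : algebraicClosure L C, b ≠ 0 → ‖(b : C)‖ = 1 := fun b hb => by
      refine le_antisymm (h2 b) ?_
      have h := h2 b⁻¹
      have hb' : 0 < ‖(b : C)‖ := norm_pos_iff.2 (by simpa using hb)
      rw [IntermediateField.coe_inv, norm_inv] at h
      exact (inv_le_one₀ hb').1 h
    by_cases ha : a = 0
    · simp [ha]
    · rw [h3 a ha, h3 _ (by simpa using ha)]

/-- Extension of an isometric automorphism of a dense subfield. -/
lemma exists_extend {C : Type*} [NormedField C] [CompleteSpace C]
    {k : Type*} [Field k] [Algebra k C] (A : IntermediateField k C)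
    (hA : Dense (A : Set C)) (σ : A ≃ₐ[k] A) (hσ : ∀ a, ‖((σ a : A) : C)‖ = ‖(a : C)‖) :
    ∃ g : C ≃+* C, (∀ y, ‖g y‖ = ‖y‖) ∧ ∀ a : A, g a = (σ a : A) := by
  have key : ∀ τ : A ≃ₐ[k] A, (∀ a, ‖((τ a : A) : C)‖ = ‖(a : C)‖) →
      ∃ g : C →+* C, Continuous g ∧ (∀ y, ‖g y‖ = ‖y‖) ∧ ∀ a : A, g a = (τ a : A) := by
    intro τ hτ
    let i : A →+* C := A.val.toRingHom
    let f : A →+* C := i.comp (τ : A →+* A)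
    have ue : IsUniformInducing i := isUniformEmbedding_subtype_val.isUniformInducing
    have dr : DenseRange i := by
      have : Set.range i = (A : Set C) := Subtype.range_coe
      rw [DenseRange, this]; exact hA
    have hf : UniformContinuous f := by
      refine Isometry.uniformContinuous (Isometry.of_dist_eq fun x y => ?_)
      rw [dist_eq_norm, ← map_sub, dist_eq_norm]
      exact hτ _
    have hc : Continuous (IsDenseInducing.extendRingHom ue dr hf) :=
      (uniformContinuous_uniformly_extend ue dr hf).continuous
    have he : ∀ a : A, IsDenseInducing.extendRingHom ue dr hf a = (τ a : A) := fun a =>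
      IsDenseInducing.extend_eq (ue.isDenseInducing dr) hf.continuous a
    refine ⟨IsDenseInducing.extendRingHom ue dr hf, hc, fun y => ?_, he⟩
    refine dr.induction_on (p := fun y => ‖IsDenseInducing.extendRingHom ue dr hf y‖ = ‖y‖) y
      (isClosed_eq hc.norm continuous_norm) fun a => ?_
    have := he a
    change ‖IsDenseInducing.extendRingHom ue dr hf (a : C)‖ = _
    rw [this]; exact hτ a
  obtain ⟨g, gc, gn, ga⟩ := key σ hσ
  obtain ⟨h, hc, hn, ha⟩ := key σ.symm (fun a => by
    have := hσ (σ.symm a); rw [AlgEquiv.apply_symm_apply] at this; exact this.symm)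
  have e1 : h.comp g = RingHom.id C := by
    refine DFunLike.coe_injective (Continuous.ext_on hA (hc.comp gc) continuous_id ?_)
    intro x hx
    change h (g ((⟨x, hx⟩ : A) : C)) = x
    rw [ga, ha]; simp
  have e2 : g.comp h = RingHom.id C := by
    refine DFunLike.coe_injective (Continuous.ext_on hA (gc.comp hc) continuous_id ?_)
    intro x hx
    change g (h ((⟨x, hx⟩ : A) : C)) = x
    rw [ha, ga]; simp
  exact ⟨RingEquiv.ofRingHom g h e2 e1, gn, ga⟩

/-- The trace argument: over a perfect base, an almost invariant element is close to the base. -/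
lemma approx {F A : Type*} [Field F] [NormedField A] [IsUltrametricDist A] [Algebra F A]
    [PerfectField F] [Normal F A] (p : ℕ) [Fact p.Prime] [CharP F p]
    (hiso : ∀ (σ : A ≃ₐ[F] A) a, ‖σ a‖ = ‖a‖) (y : A) (ε : ℝ) (hε : 0 < ε)
    (hy : ∀ σ : A ≃ₐ[F] A, ‖y - σ y‖ ≤ ε) : ∃ z : F, ‖y - algebraMap F A z‖ ≤ 2 * ε := by
  have hyi : IsIntegral F y := Normal.isIntegral inferInstance y
  have : FiniteDimensional F (IntermediateField.adjoin F {y}) :=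
    IntermediateField.adjoin.finiteDimensional hyi
  let E : IntermediateField F A := IntermediateField.normalClosure F (IntermediateField.adjoin F {y}) A
  have : FiniteDimensional F E := normalClosure.is_finiteDimensional F _ A
  have : Normal F E := normalClosure.normal F _ A
  have : IsGalois F E := ⟨⟩
  have : PerfectField E := Algebra.IsAlgebraic.perfectField (K := F) (L := E)
  have : CharP E p := charP_of_injective_algebraMap (algebraMap F E).injective p
  have hyE : y ∈ E :=
    IntermediateField.le_normalClosure _ (IntermediateField.mem_adjoin_simple_self F y)
  obtain ⟨α, hα⟩ := Algebra.trace_surjective F E 1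
  obtain ⟨n, hn⟩ : ∃ n : ℕ, ‖(α : A)‖ ≤ 2 ^ p ^ n := by
    obtain ⟨n, hn⟩ := pow_unbounded_of_one_lt ‖(α : A)‖ (one_lt_two (α := ℝ))
    refine ⟨n, hn.le.trans (pow_le_pow_right₀ one_le_two ?_)⟩
    exact (Nat.lt_pow_self (Fact.out : p.Prime).one_lt).le
  obtain ⟨β, hβ⟩ : ∃ β : E, β ^ p ^ n = α :=
    (iterateFrobeniusEquiv E p n).surjective α
  have hβ2 : ‖(β : A)‖ ≤ 2 := by
    refine le_of_pow_le_pow_left₀ (n := p ^ n) (pow_ne_zero _ (Fact.out : p.Prime).ne_zero)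
      zero_le_two ?_
    rw [← norm_pow]
    have : (β : A) ^ p ^ n = α := by rw [← hβ]; rfl
    rwa [this]
  have hsum : ∑ σ : E ≃ₐ[F] E, σ β = 1 := by
    apply (iterateFrobeniusEquiv E p n).injective
    rw [map_one, map_sum, ← map_one (algebraMap F E), ← hα, trace_eq_sum_automorphisms]
    refine Finset.sum_congr rfl fun σ _ => ?_
    rw [iterateFrobeniusEquiv_def, ← map_pow, hβ]
  refine ⟨Algebra.trace F E (β * ⟨y, hyE⟩), ?_⟩
  have hz : y - algebraMap F A (Algebra.trace F E (β * ⟨y, hyE⟩)) =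
      ∑ σ : E ≃ₐ[F] E, ((σ β : E) : A) * (y - (σ ⟨y, hyE⟩ : E)) := by
    have h1 : algebraMap F A (Algebra.trace F E (β * ⟨y, hyE⟩)) =
        ((∑ σ : E ≃ₐ[F] E, σ (β * ⟨y, hyE⟩) : E) : A) := by
      rw [← trace_eq_sum_automorphisms]; rfl
    have h2 : y = ((∑ σ : E ≃ₐ[F] E, σ β : E) : A) * y := by rw [hsum]; simp
    rw [h1]
    nth_rewrite 1 [h2]
    push_cast
    rw [Finset.sum_mul, ← Finset.sum_sub_distrib]
    refine Finset.sum_congr rfl fun σ _ => ?_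
    rw [map_mul]; push_cast; ring
  have hext : ∀ (σ : E ≃ₐ[F] E) (e : E), ((σ e : E) : A) = σ.liftNormal A (e : A) := fun σ e =>
    (σ.liftNormal_commutes A e).symm
  rw [hz]
  refine IsUltrametricDist.norm_sum_le_of_forall_le_of_nonneg (by positivity) fun σ _ => ?_
  rw [norm_mul, hext, hext, hiso]
  exact mul_le_mul hβ2 (hy _) (norm_nonneg _) zero_le_two

/-- The hard direction in normed form. -/
lemma hard {C : Type*} [NormedField C] [IsUltrametricDist C] [CompleteSpace C] [IsAlgClosed C]
    (p : ℕ) [Fact p.Prime] [CharP C p] (L : Subfield C) (hL : IsClosed (L : Set C))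
    (hA : Dense (algebraicClosure L C : Set C)) (x : C)
    (hx : ∀ g : C ≃+* C, (∀ y, ‖g y‖ = ‖y‖) → (∀ y ∈ L, g y = y) → g x = x)
    (ε : ℝ) (hε : 0 < ε) : ∃ y : C, (∃ n : ℕ, y ^ p ^ n ∈ L) ∧ ‖x - y‖ < ε := by
  have hε3 : 0 < ε / 3 := by positivity
  obtain ⟨y, hyA', hyA⟩ := Metric.dense_iff.1 hA x (ε / 3) hε3
  let A := algebraicClosure L C
  have : IsUltrametricDist A := ⟨fun x y z => IsUltrametricDist.dist_triangle_max x.1 y.1 z.1⟩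
  have : IsAlgClosed A := (algebraicClosure.isAlgClosure L C).isAlgClosed
  have : CharP L p := (algebraMap L C).charP (algebraMap L C).injective p
  let F := perfectClosure L A
  have : PerfectField F := perfectClosure.perfectField L A
  have : CharP F p := charP_of_injective_algebraMap (algebraMap L F).injective p
  have : Algebra.IsAlgebraic F A := Algebra.IsAlgebraic.tower_top (K := L) F
  have : Normal F A := normal_iff.2 fun a =>
    ⟨Algebra.IsIntegral.isIntegral a, IsAlgClosed.splits _⟩
  have hiso : ∀ (σ : A ≃ₐ[F] A) a, ‖σ a‖ = ‖a‖ := fun σ a =>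
    norm_aut L hL (σ.restrictScalars L).toAlgHom a
  obtain ⟨z, hz⟩ := approx (F := F) p hiso ⟨y, hyA⟩ (ε / 3) hε3 (fun σ => by
    obtain ⟨g, gn, ga⟩ := exists_extend A hA (σ.restrictScalars L)
      (fun a => norm_aut L hL (σ.restrictScalars L).toAlgHom a)
    have gL : ∀ w ∈ L, g w = w := fun w hw => by
      have h1 := ga (algebraMap L A ⟨w, hw⟩)
      rw [AlgEquiv.commutes] at h1
      exact h1
    have gx := hx g gn gL
    have gy : g y = (σ ⟨y, hyA⟩ : A) := ga ⟨y, hyA⟩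
    change ‖y - ((σ ⟨y, hyA⟩ : A) : C)‖ ≤ ε / 3
    have hd : y - ((σ ⟨y, hyA⟩ : A) : C) = (y - x) + g (x - y) := by
      rw [map_sub, gx, ← gy]; ring
    have hyx : ‖y - x‖ < ε / 3 := by simpa [dist_eq_norm] using hyA'
    rw [hd]
    refine (IsUltrametricDist.norm_add_le_max _ _).trans (max_le hyx.le ?_)
    rw [gn, norm_sub_rev]; exact hyx.le)
  have hzC : ‖y - ((z : A) : C)‖ ≤ 2 * (ε / 3) := hz
  refine ⟨((z : A) : C), ?_, ?_⟩
  · obtain ⟨n, w, hw⟩ := (mem_perfectClosure_iff_pow_mem (F := L) (E := A) p).1 z.2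
    refine ⟨n, ?_⟩
    have : ((z : A) : C) ^ p ^ n = (w : C) := congrArg (fun t : A => (t : C)) hw.symm
    rw [this]; exact w.2
  · have hyx : ‖x - y‖ < ε / 3 := by
      rw [norm_sub_rev]; simpa [dist_eq_norm] using hyA'
    have : x - ((z : A) : C) = (x - y) + (y - ((z : A) : C)) := by ring
    rw [this]
    exact (norm_add_le _ _).trans_lt (by linarith)

end AxSen


/-- **Ax–Sen in positive characteristic.** Let `K'` be a completed algebraic
closure of a complete nonarchimedean field `k` of characteristic `p` (so `K'` is algebraically
closed, complete, and the elements algebraic over `k` are dense). Let `L` be a complete (i.e.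
closed) subfield of `K'` containing `k` such that `k` is separably closed in `L`. Then an
element of `K'` is fixed by every continuous (isometric) automorphism of `K'` fixing `L`
pointwise if and only if it lies in the closure of the perfect closure `L^{1/p^∞}`. -/
theorem ax_sen_char_p
    {K' : Type*} [Field K'] [IsAlgClosed K'] (p : ℕ) (hp : p.Prime) [CharP K' p]
    (v : K' → ℝ)
    (hnn : ∀ x, 0 ≤ v x) (h0 : ∀ x, v x = 0 ↔ x = 0)
    (hmul : ∀ x y, v (x * y) = v x * v y)
    (hna : ∀ x y, v (x + y) ≤ max (v x) (v y))
    (hcomplete : ∀ a : ℕ → K',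
      (∀ ε : ℝ, 0 < ε → ∃ N, ∀ m ≥ N, ∀ n ≥ N, v (a m - a n) < ε) →
      ∃ l : K', ∀ ε : ℝ, 0 < ε → ∃ N, ∀ n ≥ N, v (a n - l) < ε)
    (k L : Subfield K') (hkL : k ≤ L)
    (halgdense : ∀ x : K', ∀ ε : ℝ, 0 < ε → ∃ y : K', IsAlgebraic k y ∧ v (x - y) < ε)
    (hkclosed : ∀ x : K', (∀ ε : ℝ, 0 < ε → ∃ y ∈ k, v (x - y) < ε) → x ∈ k)
    (hLclosed : ∀ x : K', (∀ ε : ℝ, 0 < ε → ∃ y ∈ L, v (x - y) < ε) → x ∈ L)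
    (hsepcl : ∀ x : K', x ∈ L → IsIntegral k x → IsSeparable k x → x ∈ k) :
    ∀ x : K',
      (∀ g : K' ≃+* K', (∀ y, v (g y) = v y) → (∀ y ∈ L, g y = y) → g x = x) ↔
      (∀ ε : ℝ, 0 < ε → ∃ y : K', (∃ n : ℕ, y ^ p ^ n ∈ L) ∧ v (x - y) < ε) := by
  have : Fact p.Prime := ⟨hp⟩
  intro x
  constructor
  · intro hx
    let w : AbsoluteValue K' ℝ :=
      { toFun := v
        map_mul' := hmul
        nonneg' := hnn
        eq_zero' := h0
        add_le' := fun a b => (hna a b).trans (max_le_add_of_nonneg (hnn a) (hnn b)) }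
    let inst : NormedField K' := w.toNormedField
    have hw : ∀ a : K', ‖a‖ = v a := fun a => rfl
    have : IsUltrametricDist K' :=
      IsUltrametricDist.isUltrametricDist_of_isNonarchimedean_norm hna
    have : CompleteSpace K' := by
      refine Metric.complete_of_cauchySeq_tendsto fun u hu => ?_
      obtain ⟨l, hl⟩ := hcomplete u (fun ε hε => by
        obtain ⟨N, hN⟩ := Metric.cauchySeq_iff.1 hu ε hε
        refine ⟨N, fun m hm n hn => ?_⟩
        rw [← hw, ← dist_eq_norm]
        exact hN m hm n hn)
      refine ⟨l, Metric.tendsto_atTop.2 fun ε hε => ?_⟩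
      obtain ⟨N, hN⟩ := hl ε hε
      refine ⟨N, fun n hn => ?_⟩
      rw [dist_eq_norm]
      exact hN n hn
    have hLc : IsClosed (L : Set K') := by
      refine isClosed_of_closure_subset fun a ha => hLclosed a fun ε hε => ?_
      obtain ⟨b, hb, hab⟩ := Metric.mem_closure_iff.1 ha ε hε
      rw [dist_eq_norm] at hab
      exact ⟨b, hb, hab⟩
    have hA : Dense (algebraicClosure L K' : Set K') := by
      refine fun a => Metric.mem_closure_iff.2 fun ε hε => ?_
      obtain ⟨b, hb, hab⟩ := halgdense a ε hε
      refine ⟨b, mem_algebraicClosure_iff.2 ?_, by rw [dist_eq_norm]; exact hab⟩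
      obtain ⟨q, hq, hqb⟩ := hb
      refine ⟨q.map (Subfield.inclusion hkL),
        (Polynomial.map_ne_zero_iff (RingHom.injective _)).2 hq, ?_⟩
      rw [Polynomial.aeval_def, Polynomial.eval₂_map]
      exact hqb
    intro ε hε
    exact AxSen.hard p L hLc hA x hx ε hε
  · intro hx g hg hgL
    have hneg : ∀ a, v (-a) = v a := fun a => by
      have h1 : v (-1) * v (-1) = 1 * v 1 := by rw [← hmul, one_mul]; simp
      have h2 : v 1 = 1 := by
        have h3 : v 1 * v 1 = v 1 := by rw [← hmul, one_mul]
        exact mul_right_cancel₀ (fun h => one_ne_zero ((h0 1).1 h)) (h3.trans (one_mul _).symm)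
      have h4 : v (-1) = 1 := by
        rw [h2] at h1
        nlinarith [hnn (-1)]
      rw [← neg_one_mul, hmul, h4, one_mul]
    by_contra hne
    have hpos : 0 < v (g x - x) :=
      lt_of_le_of_ne (hnn _) fun h => hne (sub_eq_zero.1 ((h0 _).1 h.symm))
    obtain ⟨y, ⟨n, hn⟩, hy⟩ := hx _ hpos
    have hgy : g y = y := by
      apply iterateFrobenius_inj K' p n
      rw [iterateFrobenius_def, iterateFrobenius_def, ← map_pow]
      exact hgL _ hn
    have hd : g x - x = g (x - y) + -(x - y) := by rw [map_sub, hgy]; ring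
    have := hna (g (x - y)) (-(x - y))
    rw [← hd, hneg, hg, max_self] at this
    exact absurd hy (not_lt.2 this)
end

section
/- Let p be a prime, k a field of characteristic p, and let (d_i) be a sequence of positive integers such that p^{-i} d_i is strictly increasing and bounded, and p ∤ d_i for all i. Let c_i ∈ k be such that each 𝔽_p(c_i) is finite but 𝔽_p(c_1, c_2, …) is infinite. Then the generalized power series x = Σ_{i=0}^∞ c_i t^{d_i/p^i} ∈ k((t^ℚ)) (Hahn series over k with exponents in ℚ) is transcendental over the subfield k(t). -/
namespace HahnTrans

open Polynomial

variable {k : Type*} [Field k]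

/-- The embedding of `k[t]` into the Hahn series field. -/
noncomputable def psi (k : Type*) [Field k] : k[X] →+* HahnSeries ℚ k :=
  Polynomial.eval₂RingHom HahnSeries.C (HahnSeries.single (1 : ℚ) (1 : k))

lemma psi_monomial (m : ℕ) (a : k) :
    psi k (monomial m a) = HahnSeries.single (m : ℚ) a := by
  simp [psi, HahnSeries.single_pow, eval₂_monomial, HahnSeries.C_apply]

lemma psi_coeff (P : k[X]) (n : ℕ) : (psi k P).coeff (n : ℚ) = P.coeff n := by
  induction P using Polynomial.induction_on' with
  | add p q hp hq => simp [hp, hq]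
  | monomial m a =>
    rw [psi_monomial, coeff_monomial, HahnSeries.coeff_single]
    simp [eq_comm]

lemma psi_injective : Function.Injective (psi k) := by
  intro P Q h
  ext n
  rw [← psi_coeff, ← psi_coeff, h]

/-- Coefficientwise application of a ring homomorphism. -/
noncomputable def mapHom (f : k →+* k) : HahnSeries ℚ k →+* HahnSeries ℚ k where
  toFun y := y.map f
  map_one' := by
    ext q
    simp only [HahnSeries.map_coeff, HahnSeries.coeff_one]
    split_ifs <;> simp
  map_zero' := by ext; simp
  map_add' a b := by ext; simp
  map_mul' a b := HahnSeries.map_mul (f : k →ₙ+* k)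

lemma mapHom_coeff (f : k →+* k) (y : HahnSeries ℚ k) (q : ℚ) :
    (mapHom f y).coeff q = f (y.coeff q) := rfl

lemma mapHom_psi (f : k →+* k) (P : k[X]) : mapHom f (psi k P) = psi k (P.map f) := by
  induction P using Polynomial.induction_on' with
  | add p q hp hq => simp [hp, hq]
  | monomial m a =>
    rw [Polynomial.map_monomial, psi_monomial, psi_monomial]
    ext q
    rw [mapHom_coeff, HahnSeries.coeff_single, HahnSeries.coeff_single]
    split_ifs <;> simp

/-- Hahn series with coefficients in a subfield. -/
def coeffSubring (K : Subfield k) : Submonoid (HahnSeries ℚ k) where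
  carrier := {y | ∀ q, y.coeff q ∈ K}
  one_mem' := by
    intro q
    rw [HahnSeries.coeff_one]
    split_ifs
    · exact one_mem K
    · exact zero_mem K
  mul_mem' := by
    intro a b ha hb q
    rw [HahnSeries.coeff_mul]
    exact sum_mem fun i _ => mul_mem (ha _) (hb _)

lemma single_mem (K : Subfield k) (q : ℚ) : HahnSeries.single q (1 : k) ∈ coeffSubring K := by
  intro r
  rw [HahnSeries.coeff_single]
  split_ifs
  · exact one_mem K
  · exact zero_mem K

lemma functional (K : Subfield k) (φ : k →ₗ[K] K) (x : HahnSeries ℚ k)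
    (hx : ∀ q, x.coeff q ∈ K) (P : k[X][X]) :
    ∃ Q : k[X][X], (∀ n m, (Q.coeff n).coeff m = (φ ((P.coeff n).coeff m) : k)) ∧
      ∀ q, (Q.eval₂ (psi k) x).coeff q = (φ ((P.eval₂ (psi k) x).coeff q) : k) := by
  induction P using Polynomial.induction_on' with
  | add p q hp hq =>
    obtain ⟨Q, h1, h2⟩ := hp
    obtain ⟨R, h3, h4⟩ := hq
    refine ⟨Q + R, fun n m => by simp [h1, h3], fun r => ?_⟩
    simp [h2, h4, eval₂_add]
  | monomial n P =>
    induction P using Polynomial.induction_on' with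
    | add p q hp hq =>
      obtain ⟨Q, h1, h2⟩ := hp
      obtain ⟨R, h3, h4⟩ := hq
      refine ⟨Q + R, fun n m => by simp [h1, h3, (monomial _).map_add], fun r => ?_⟩
      simp [h2, h4, eval₂_add, (monomial _).map_add]
    | monomial m a =>
      refine ⟨monomial n (monomial m (φ a : k)), fun n' m' => ?_, fun q => ?_⟩
      · rw [coeff_monomial, coeff_monomial]
        split_ifs
        · rw [coeff_monomial, coeff_monomial]
          split_ifs <;> simp
        · simp
      · have hy : HahnSeries.single (m : ℚ) (1 : k) * x ^ n ∈ coeffSubring K :=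
          mul_mem (single_mem K _) (pow_mem (show x ∈ coeffSubring K from hx) n)
        have key : ∀ b : k, ((monomial n (monomial m b)).eval₂ (psi k) x).coeff q =
            b * (HahnSeries.single (m : ℚ) (1 : k) * x ^ n).coeff q := by
          intro b
          have hs : HahnSeries.single (m : ℚ) b =
              HahnSeries.single (0 : ℚ) b * HahnSeries.single (m : ℚ) (1 : k) := by simp
          rw [eval₂_monomial, psi_monomial, hs, mul_assoc, HahnSeries.coeff_single_zero_mul]
        rw [key, key]
        have h := φ.map_smul ⟨_, hy q⟩ a
        rw [mul_comm a]
        have h' := congrArg (Subtype.val) h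
        rw [mul_comm]
        exact h'.symm

lemma exists_frob (p : ℕ) [Fact p.Prime] [Algebra (ZMod p) k] (b : k)
    (hb : IsAlgebraic (ZMod p) b) : ∃ N, 0 < N ∧ b ^ p ^ N = b := by
  have : FiniteDimensional (ZMod p) (IntermediateField.adjoin (ZMod p) {b}) :=
    IntermediateField.adjoin.finiteDimensional hb.isIntegral
  have : Finite (IntermediateField.adjoin (ZMod p) {b}) := Module.finite_of_finite (ZMod p)
  let _ := Fintype.ofFinite (IntermediateField.adjoin (ZMod p) {b})
  refine ⟨Module.finrank (ZMod p) (IntermediateField.adjoin (ZMod p) {b}),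
    Module.finrank_pos, ?_⟩
  have h := FiniteField.pow_card
    (⟨b, IntermediateField.mem_adjoin_simple_self _ b⟩ : IntermediateField.adjoin (ZMod p) {b})
  rw [Module.card_eq_pow_finrank (K := ZMod p), ZMod.card] at h
  exact congrArg Subtype.val h

lemma frob_mul {p N : ℕ} {b : k} (h : b ^ p ^ N = b) (M : ℕ) : b ^ p ^ (N * M) = b := by
  induction M with
  | zero => simp
  | succ M ih => rw [Nat.mul_succ, pow_add, pow_mul, ih, h]

lemma exists_frob_finset (p : ℕ) [Fact p.Prime] [Algebra (ZMod p) k] (s : Finset k)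
    (hs : ∀ b ∈ s, IsAlgebraic (ZMod p) b) : ∃ N, 0 < N ∧ ∀ b ∈ s, b ^ p ^ N = b := by
  classical
  induction s using Finset.induction_on with
  | empty => exact ⟨1, one_pos, by simp⟩
  | insert a s ha ih =>
    obtain ⟨N, hN, h1⟩ := ih fun b hb => hs b (Finset.mem_insert_of_mem hb)
    obtain ⟨M, hM, h2⟩ := exists_frob p a (hs a (Finset.mem_insert_self _ _))
    refine ⟨N * M, Nat.mul_pos hN hM, fun b hb => ?_⟩
    rcases Finset.mem_insert.1 hb with rfl | hb
    · rw [mul_comm]; exact frob_mul h2 N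
    · exact frob_mul (h1 b hb) M

lemma isAlgebraic_poly (x : HahnSeries ℚ k)
    (h : IsAlgebraic (Subfield.closure (Set.range (HahnSeries.C : k →+* HahnSeries ℚ k) ∪
        {HahnSeries.single (1 : ℚ) (1 : k)})) x) :
    ∃ P : k[X][X], P ≠ 0 ∧ P.eval₂ (psi k) x = 0 := by
  set S := Subfield.closure (Set.range (HahnSeries.C : k →+* HahnSeries ℚ k) ∪
        {HahnSeries.single (1 : ℚ) (1 : k)}) with hS
  let _ : Algebra k[X] (HahnSeries ℚ k) := (psi k).toAlgebra
  have hmem : ∀ P, psi k P ∈ S := by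
    intro P
    have ht : HahnSeries.single (1 : ℚ) (1 : k) ∈ S := Subfield.subset_closure (Or.inr rfl)
    simp only [psi, coe_eval₂RingHom, eval₂_eq_sum]
    exact sum_mem fun i _ => mul_mem (Subfield.subset_closure (Or.inl ⟨_, rfl⟩)) (pow_mem ht _)
  let _ : Algebra k[X] S := ((psi k).codRestrict S hmem).toAlgebra
  have : IsScalarTower k[X] S (HahnSeries ℚ k) := IsScalarTower.of_algebraMap_eq fun _ => rfl
  have halg : ∀ y ∈ S, IsAlgebraic k[X] y := by
    intro y hy
    induction hy using Subfield.closure_induction with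
    | mem y hy =>
      rcases hy with ⟨a, rfl⟩ | rfl
      · have : HahnSeries.C a = algebraMap k[X] (HahnSeries ℚ k) (C a) := by
          change _ = psi k (C a)
          simp [psi]
        rw [this]; exact isAlgebraic_algebraMap _
      · have : HahnSeries.single (1 : ℚ) (1 : k) = algebraMap k[X] (HahnSeries ℚ k) X := by
          change _ = psi k X
          simp [psi]
        rw [this]; exact isAlgebraic_algebraMap _
    | one => exact isAlgebraic_one
    | add _ _ _ _ h1 h2 => exact h1.add h2
    | neg _ _ h => exact h.neg
    | inv _ _ h => exact h.inv
    | mul _ _ _ _ h1 h2 => exact h1.mul h2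
  have : Algebra.IsAlgebraic k[X] S := ⟨fun y =>
    (isAlgebraic_algebraMap_iff (A := HahnSeries ℚ k) Subtype.val_injective).1 (halg y y.2)⟩
  obtain ⟨P, hP, h0⟩ := h.restrictScalars k[X]
  exact ⟨P, hP, h0⟩

lemma main {k : Type*} [Field k] (p : ℕ) [Fact p.Prime] [CharP k p] [Algebra (ZMod p) k]
    (x : HahnSeries ℚ k) (hx : ∀ q, IsAlgebraic (ZMod p) (x.coeff q))
    (h : ∃ P : k[X][X], P ≠ 0 ∧ P.eval₂ (psi k) x = 0) :
    ∃ N, 0 < N ∧ ∀ q, x.coeff q ^ p ^ N = x.coeff q := by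
  classical
  obtain ⟨P, hP, h0⟩ := h
  let K : Subfield k := (algebraicClosure (ZMod p) k).toSubfield
  obtain ⟨n, hn⟩ : ∃ n, P.coeff n ≠ 0 := by
    by_contra! hh; exact hP (Polynomial.ext (by simpa using hh))
  obtain ⟨m, hm⟩ : ∃ m, (P.coeff n).coeff m ≠ 0 := by
    by_contra! hh; exact hn (Polynomial.ext (by simpa using hh))
  obtain ⟨φ, hφ⟩ : ∃ φ : k →ₗ[K] K, φ ((P.coeff n).coeff m) ≠ 0 := by
    by_contra! hh
    exact hm ((Module.forall_dual_apply_eq_zero_iff K _).1 hh)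
  obtain ⟨Q, hQ, hQ0⟩ := functional K φ x (fun q => mem_algebraicClosure_iff.2 (hx q)) P
  have hQne : Q ≠ 0 := by
    rintro rfl
    apply hφ
    have := hQ n m
    simpa using this.symm
  have hQe : Q.eval₂ (psi k) x = 0 := by
    ext q
    rw [hQ0, h0]; simp
  obtain ⟨N, hN, hfix⟩ := exists_frob_finset p (Q.coeffs.biUnion fun R => R.coeffs) (by
    intro b hb
    simp only [Finset.mem_biUnion, Polynomial.mem_coeffs_iff] at hb
    obtain ⟨_, ⟨i, _, rfl⟩, j, _, rfl⟩ := hb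
    rw [hQ]
    exact mem_algebraicClosure_iff.1 (φ _).2)
  have hfix' : ∀ i, (Q.coeff i).map (iterateFrobenius k p N) = Q.coeff i := by
    intro i
    ext j
    rw [coeff_map, iterateFrobenius_def]
    by_cases h0 : (Q.coeff i).coeff j = 0
    · rw [h0, zero_pow]
      exact pow_ne_zero _ (Fact.out : p.Prime).ne_zero
    · apply hfix
      simp only [Finset.mem_biUnion]
      have hi : Q.coeff i ≠ 0 := by rintro h; simp [h] at h0
      exact ⟨_, Polynomial.coeff_mem_coeffs hi, Polynomial.coeff_mem_coeffs h0⟩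
  set σ := mapHom (iterateFrobenius k p N) with hσ
  have hroot : ∀ y, Q.eval₂ (psi k) y = 0 → Q.eval₂ (psi k) (σ y) = 0 := by
    intro y hy
    have h1 : σ (Q.eval₂ (psi k) y) = 0 := by rw [hy, map_zero]
    rw [hom_eval₂] at h1
    rw [← h1, eval₂_eq_sum, eval₂_eq_sum]
    refine Finset.sum_congr rfl fun i _ => ?_
    simp only [RingHom.comp_apply]
    rw [hσ, mapHom_psi, hfix']
  have hroots : ∀ i : ℕ, (Q.map (psi k)).IsRoot (σ^[i] x) := by
    intro i
    rw [IsRoot, eval_map]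
    induction i with
    | zero => exact hQe
    | succ i ih => rw [Function.iterate_succ_apply']; exact hroot _ ih
  have hne : Q.map (psi k) ≠ 0 := (Polynomial.map_ne_zero_iff psi_injective).2 hQne
  have hfin := Polynomial.finite_setOfPred_isRoot hne
  have hco : ∀ (i : ℕ) q, (σ^[i] x).coeff q = x.coeff q ^ p ^ (N * i) := by
    intro i q
    induction i with
    | zero => simp
    | succ i ih =>
      rw [Function.iterate_succ_apply', hσ, mapHom_coeff, ← hσ, ih, iterateFrobenius_def,
        ← pow_mul, ← pow_add, Nat.mul_succ]
  obtain ⟨i, j, hij, he⟩ : ∃ i j : ℕ, i < j ∧ σ^[i] x = σ^[j] x := by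
    have hni : ¬ Function.Injective (fun i : ℕ => σ^[i] x) := by
      intro hinj
      exact Set.infinite_range_of_injective hinj
        (hfin.subset (by rintro _ ⟨i, rfl⟩; exact hroots i))
    simp only [Function.Injective, not_forall] at hni
    obtain ⟨i, j, he, hij⟩ := hni
    rcases lt_or_gt_of_ne hij with h | h
    · exact ⟨i, j, h, he⟩
    · exact ⟨j, i, h, he.symm⟩
  refine ⟨N * (j - i), Nat.mul_pos hN (by omega), fun q => ?_⟩
  apply iterateFrobenius_inj k p (N * i)
  rw [iterateFrobenius_def, iterateFrobenius_def, ← pow_mul, ← pow_add, ← Nat.mul_add,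
    Nat.sub_add_cancel hij.le, ← hco, ← hco, he]

lemma adjoin_finite {k : Type*} [Field k] (p : ℕ) [Fact p.Prime] [CharP k p] [Algebra (ZMod p) k]
    (c : ℕ → k) (N : ℕ) (hN : 0 < N) (h : ∀ i, c i ^ p ^ N = c i) :
    Finite (Algebra.adjoin (ZMod p) (Set.range c)) := by
  have h1 : 1 < p ^ N := Nat.one_lt_pow hN.ne' (Fact.out : p.Prime).one_lt
  have hne : (X ^ p ^ N - X : k[X]) ≠ 0 := FiniteField.X_pow_card_sub_X_ne_zero k h1
  refine ((Polynomial.finite_setOfPred_isRoot hne).subset ?_).to_subtype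
  intro y hy
  suffices y ^ p ^ N = y by simp [this, sub_eq_zero]
  induction hy using Algebra.adjoin_induction with
  | mem y hy => obtain ⟨i, rfl⟩ := hy; exact h i
  | algebraMap r => rw [← map_pow, ZMod.pow_card_pow]
  | add a b _ _ ha hb => rw [add_pow_char_pow, ha, hb]
  | mul a b _ _ ha hb => rw [mul_pow, ha, hb]

end HahnTrans


/-- Let `k` be a field of characteristic `p`, `(d i)` positive integers with
`p ∤ d i` and `d i / p^i` strictly increasing and bounded, and `c i ∈ k` such that each
`𝔽_p(c_i)` is finite (each `c i` is algebraic over `𝔽_p`) but `𝔽_p(c_0, c_1, …)` is infinite.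
Then the generalized power series `x = ∑_i c_i t^{d_i/p^i}` in the Hahn series field
`k((t^ℚ))` is transcendental over the subfield `k(t)`. -/
theorem hahn_series_transcendental
    {k : Type*} [Field k] (p : ℕ) (hp : p.Prime) [CharP k p] [Algebra (ZMod p) k]
    (d : ℕ → ℕ) (hdpos : ∀ i, 0 < d i) (hdp : ∀ i, ¬ p ∣ d i)
    (hmono : StrictMono (fun i : ℕ => (d i : ℝ) / (p : ℝ) ^ i))
    (hbdd : ∃ B : ℝ, ∀ i, (d i : ℝ) / (p : ℝ) ^ i ≤ B)
    (c : ℕ → k) (hc : ∀ i, IsAlgebraic (ZMod p) (c i))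
    (hcinf : Infinite (Algebra.adjoin (ZMod p) (Set.range c)))
    (x : HahnSeries ℚ k)
    (hxc : ∀ i, x.coeff ((d i : ℚ) / (p : ℚ) ^ i) = c i)
    (hxz : ∀ q : ℚ, (∀ i, q ≠ (d i : ℚ) / (p : ℚ) ^ i) → x.coeff q = 0) :
    Transcendental
      (Subfield.closure (Set.range (HahnSeries.C : k →+* HahnSeries ℚ k) ∪
        {HahnSeries.single (1 : ℚ) (1 : k)}))
      x := by
  have : Fact p.Prime := ⟨hp⟩
  intro h
  obtain ⟨N, hN, hfix⟩ := HahnTrans.main p x (fun q => by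
    by_cases hq : ∃ i, q = (d i : ℚ) / (p : ℚ) ^ i
    · obtain ⟨i, rfl⟩ := hq
      rw [hxc]; exact hc i
    · push Not at hq
      rw [hxz q hq]; exact isAlgebraic_zero) (HahnTrans.isAlgebraic_poly x h)
  have hfin := HahnTrans.adjoin_finite p c N hN (fun i => by rw [← hxc i]; exact hfix _)
  exact not_finite (Algebra.adjoin (ZMod p) (Set.range c))
end
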